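/- arXiv:2602.14506 — 5 statements merged into one kernel-verified Lean document; each statement's English description precedes it below -/
import Mathlib

section
/- Let A ∈ ℝ^{n×n} be symmetric positive definite with L = λ_max(A), b ∈ ℝⁿ, λ > 0, and 0 < γ ≤ 1/L. Define F(x) = ½ xᵀ A x + bᵀ x + λ‖x‖₁ and the ISTA update x_{k+1} = S_{γλ}(x_k − γ(A x_k + b)). Then F(x_{k+1}) ≤ F(x_k) for every k. -/
open Matrix

/-- The soft-thresholding operator, applied componentwise. -/
noncomputable def softThresh {n : ℕ} (θ : ℝ) (y : Fin n → ℝ) : Fin n → ℝ :=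
  fun i => Real.sign (y i) * max (|y i| - θ) 0

/-- The ℓ1-regularized quadratic objective `F(x) = ½ xᵀAx + bᵀx + λ‖x‖₁`. -/
noncomputable def Fobj {n : ℕ} (A : Matrix (Fin n) (Fin n) ℝ) (b : Fin n → ℝ)
    (lam : ℝ) (x : Fin n → ℝ) : ℝ :=
  (1 / 2) * (x ⬝ᵥ A.mulVec x) + b ⬝ᵥ x + lam * ∑ i, |x i|

lemma ista_scalar (x g θ : ℝ) (hθ : 0 < θ) :
    θ * |Real.sign (x - g) * max (|x - g| - θ) 0|
      + g * (Real.sign (x - g) * max (|x - g| - θ) 0 - x)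
      + (Real.sign (x - g) * max (|x - g| - θ) 0 - x) ^ 2 / 2 ≤ θ * |x| := by
  have h1 : θ * x ≤ θ * |x| := mul_le_mul_of_nonneg_left (le_abs_self x) hθ.le
  have h2 : θ * (-x) ≤ θ * |x| := mul_le_mul_of_nonneg_left (neg_le_abs x) hθ.le
  rcases le_or_gt |x - g| θ with h | h
  · rw [max_eq_right (by linarith)]
    simp only [mul_zero, abs_zero, zero_sub]
    obtain ⟨ha, hb⟩ := abs_le.1 h
    have hx : (x - g) * x ≤ θ * |x| := by
      calc (x - g) * x ≤ |(x - g) * x| := le_abs_self _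
        _ = |x - g| * |x| := abs_mul _ _
        _ ≤ θ * |x| := mul_le_mul_of_nonneg_right h (abs_nonneg x)
    nlinarith [sq_nonneg x]
  · rw [max_eq_left (by linarith)]
    rcases lt_abs.1 h with h' | h'
    · have hp : 0 < x - g := by linarith
      rw [Real.sign_of_pos hp, abs_of_pos hp, one_mul, abs_of_pos (by linarith)]
      nlinarith [sq_nonneg (g + θ)]
    · have hp : x - g < 0 := by linarith
      rw [Real.sign_of_neg hp, abs_of_neg hp, abs_of_neg (by linarith)]
      nlinarith [sq_nonneg (g - θ)]

open scoped MatrixOrder in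
lemma ista_quad {n : ℕ} (A : Matrix (Fin n) (Fin n) ℝ) (hA : A.IsHermitian) (L : ℝ)
    (hL : ∀ i, hA.eigenvalues i ≤ L) (d : Fin n → ℝ) :
    d ⬝ᵥ A.mulVec d ≤ L * (d ⬝ᵥ d) := by
  have h : A ≤ algebraMap ℝ _ L := by
    rw [le_algebraMap_iff_spectrum_le (ha := hA.isSelfAdjoint)]
    intro x hx
    rw [hA.spectrum_real_eq_range_eigenvalues] at hx
    obtain ⟨i, rfl⟩ := hx
    exact hL i
  have h2 := (Matrix.le_iff.1 h).dotProduct_mulVec_nonneg d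
  simp only [star_trivial, Matrix.sub_mulVec, dotProduct_sub, Algebra.algebraMap_eq_smul_one,
    Matrix.smul_mulVec, Matrix.one_mulVec, dotProduct_smul, smul_eq_mul] at h2
  linarith

/-- For `A` symmetric positive definite with `L = λ_max(A)`, `λ > 0` and
`0 < γ ≤ 1/L`, the ISTA iterates `x_{k+1} = S_{γλ}(x_k - γ(A x_k + b))`
monotonically decrease the objective `F`. -/
theorem ista_monotone_decrease
    {n : ℕ} (A : Matrix (Fin n) (Fin n) ℝ) (hA : A.PosDef)
    (b : Fin n → ℝ) (lam γ L : ℝ) (hlam : 0 < lam)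
    (hL : L = ⨆ i, hA.1.eigenvalues i)
    (hγ : 0 < γ) (hγL : γ ≤ 1 / L)
    (x : ℕ → Fin n → ℝ)
    (hx : ∀ k, x (k + 1) = softThresh (γ * lam) (x k - γ • (A.mulVec (x k) + b))) :
    ∀ k : ℕ, Fobj A b lam (x (k + 1)) ≤ Fobj A b lam (x k) := by
  intro k
  have hLpos : 0 < L := by
    have : 0 < 1 / L := lt_of_lt_of_le hγ hγL
    exact one_div_pos.1 this
  have hγL' : γ * L ≤ 1 := by rwa [le_div_iff₀ hLpos] at hγL
  have hle : ∀ i, hA.1.eigenvalues i ≤ L := fun i => by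
    rw [hL]; exact le_ciSup (Set.finite_range _).bddAbove i
  obtain ⟨d, hd⟩ : ∃ d, d = x (k + 1) - x k := ⟨_, rfl⟩
  have hu : x (k + 1) = x k + d := by rw [hd]; abel
  have hq := ista_quad A hA.1 L hle d
  have hdd : 0 ≤ d ⬝ᵥ d := by
    simp only [dotProduct]; exact Finset.sum_nonneg fun i _ => mul_self_nonneg _
  have hs : ∀ i, γ * lam * |x (k + 1) i| + γ * ((A.mulVec (x k) + b) i) * d i + d i * d i / 2
      ≤ γ * lam * |x k i| := by
    intro i
    have h := ista_scalar (x k i) (γ * ((A.mulVec (x k) + b) i)) (γ * lam) (mul_pos hγ hlam)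
    have e : x (k + 1) i = Real.sign (x k i - γ * ((A.mulVec (x k) + b) i)) *
        max (|x k i - γ * ((A.mulVec (x k) + b) i)| - γ * lam) 0 := by
      rw [hx k]; rfl
    rw [← e] at h
    have e2 : d i = x (k + 1) i - x k i := by rw [hd]; rfl
    rw [e2]
    linarith
  have hsum := Finset.sum_le_sum fun i (_ : i ∈ Finset.univ) => hs i
  have hsum' : γ * lam * ∑ i, |x (k + 1) i| + γ * ((A.mulVec (x k) + b) ⬝ᵥ d) + (d ⬝ᵥ d) / 2
      ≤ γ * lam * ∑ i, |x k i| := by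
    simpa only [Finset.sum_add_distrib, dotProduct, Finset.mul_sum, Finset.sum_div, mul_assoc]
      using hsum
  have hsym : x k ⬝ᵥ A.mulVec d = A.mulVec (x k) ⬝ᵥ d := by
    have ht : Aᵀ = A := by simpa [Matrix.IsHermitian] using hA.1
    rw [Matrix.dotProduct_mulVec, ← Matrix.mulVec_transpose, ht]
  have hq2 : γ * (d ⬝ᵥ A.mulVec d) ≤ d ⬝ᵥ d := by
    nlinarith [mul_le_mul_of_nonneg_left hq hγ.le, mul_le_mul_of_nonneg_right hγL' hdd]
  have hF : Fobj A b lam (x (k + 1)) = 1 / 2 * (x k ⬝ᵥ A.mulVec (x k))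
      + (A.mulVec (x k) + b) ⬝ᵥ d + 1 / 2 * (d ⬝ᵥ A.mulVec d) + b ⬝ᵥ x k
      + lam * ∑ i, |x (k + 1) i| := by
    unfold Fobj
    generalize ∑ i, |x (k + 1) i| = S
    rw [hu, Matrix.mulVec_add, dotProduct_add, add_dotProduct, add_dotProduct, dotProduct_add,
      add_dotProduct, hsym, dotProduct_comm d (A.mulVec (x k))]
    ring
  rw [hF]
  unfold Fobj
  refine le_of_mul_le_mul_left ?_ hγ
  linarith
end

section
/- Let A ∈ ℝ^{n×n} be symmetric positive definite with L = λ_max(A), b ∈ ℝⁿ, λ > 0, and 0 < γ ≤ 1/L. Let F(x) = ½ xᵀ A x + bᵀ x + λ‖x‖₁, let x⋆ be a minimizer of F, and define the ISTA iterates x_{k+1} = S_{γλ}(x_k − γ(A x_k + b)) from any x_0 ∈ ℝⁿ. Then for every k ≥ 1, F(x_k) − F(x⋆) ≤ ‖x_0 − x⋆‖₂² / (2γk); in particular F(x_k) → F(x⋆). -/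
open Matrix Filter

theorem quad_le {n : ℕ} (A : Matrix (Fin n) (Fin n) ℝ) (hA : A.IsHermitian) (v : Fin n → ℝ) :
    v ⬝ᵥ A.mulVec v ≤ (⨆ i, hA.eigenvalues i) * ∑ i, v i ^ 2 := by
  set L := ⨆ i, hA.eigenvalues i with hL
  have hle : ∀ i, hA.eigenvalues i ≤ L := fun i => le_ciSup (Set.finite_range _).bddAbove i
  set U : Matrix (Fin n) (Fin n) ℝ := (hA.eigenvectorUnitary : Matrix (Fin n) (Fin n) ℝ) with hU
  have hUU : U * Uᴴ = 1 := by
    have := Unitary.mul_star_self_of_mem hA.eigenvectorUnitary.2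
    simpa [star_eq_conjTranspose] using this
  have hs : A = U * diagonal hA.eigenvalues * Uᴴ := by
    have := hA.spectral_theorem
    rw [Unitary.conjStarAlgAut_apply] at this
    simpa [star_eq_conjTranspose, Function.comp_def] using this
  have hps : (L • (1 : Matrix (Fin n) (Fin n) ℝ) - A).PosSemidef := by
    have h1 : (diagonal (fun i => L - hA.eigenvalues i)).PosSemidef :=
      PosSemidef.diagonal (fun i => sub_nonneg.2 (hle i))
    have h2 := h1.mul_mul_conjTranspose_same U
    have h3 : diagonal (fun i => L - hA.eigenvalues i)
        = L • (1 : Matrix (Fin n) (Fin n) ℝ) - diagonal hA.eigenvalues := by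
      ext i j
      by_cases h : i = j
      · subst h; simp
      · simp [h]
    rw [h3, mul_sub, sub_mul, ← hs] at h2
    rwa [mul_smul_comm, mul_one, smul_mul_assoc, hUU] at h2
  have := hps.dotProduct_mulVec_nonneg v
  have e : v ⬝ᵥ v = ∑ i, v i ^ 2 := by simp [dotProduct, sq]
  simp only [star_trivial, sub_mulVec, smul_mulVec, one_mulVec, dotProduct_sub,
    dotProduct_smul, smul_eq_mul, e] at this
  linarith

theorem soft_ineq (θ w u : ℝ) (hθ : 0 < θ) :
    (w - Real.sign w * max (|w| - θ) 0) * (u - Real.sign w * max (|w| - θ) 0)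
      ≤ θ * (|u| - |Real.sign w * max (|w| - θ) 0|) := by
  have hu1 := le_abs_self u
  have hu2 := neg_abs_le u
  rcases le_total (|w|) θ with h | h
  · rw [max_eq_right (by linarith)]
    simp only [mul_zero, sub_zero, abs_zero]
    calc w * u ≤ |w * u| := le_abs_self _
      _ = |w| * |u| := abs_mul _ _
      _ ≤ θ * |u| := by gcongr
  · rw [max_eq_left (by linarith)]
    rcases le_total 0 w with h0 | h0
    · rw [abs_of_nonneg h0] at h ⊢
      rw [Real.sign_of_pos (by linarith), one_mul, abs_of_nonneg (by linarith : (0:ℝ) ≤ w - θ)]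
      nlinarith
    · rw [abs_of_nonpos h0] at h ⊢
      rw [Real.sign_of_neg (by linarith), abs_of_nonpos (by linarith : -1 * (-w - θ) ≤ (0:ℝ))]
      nlinarith

theorem quad_expand {n : ℕ} (A : Matrix (Fin n) (Fin n) ℝ) (hA : A.IsHermitian)
    (y d : Fin n → ℝ) :
    d ⬝ᵥ A.mulVec d = y ⬝ᵥ A.mulVec y + 2 * (A.mulVec y ⬝ᵥ (d - y))
      + (d - y) ⬝ᵥ A.mulVec (d - y) := by
  have hT : Aᵀ = A := by simpa [conjTranspose_eq_transpose_of_trivial] using hA.eq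
  have hs : y ⬝ᵥ A.mulVec d = d ⬝ᵥ A.mulVec y := by
    rw [dotProduct_mulVec, ← mulVec_transpose, hT, dotProduct_comm]
  simp only [mulVec_sub, dotProduct_sub, sub_dotProduct, hs, dotProduct_comm (A.mulVec y)]
  ring

theorem ista_step {n : ℕ} (A : Matrix (Fin n) (Fin n) ℝ) (hA : A.PosDef)
    (b : Fin n → ℝ) (lam γ : ℝ) (hlam : 0 < lam) (hγ : 0 < γ)
    (hQ : ∀ v : Fin n → ℝ, γ * (v ⬝ᵥ A.mulVec v) ≤ ∑ i, v i ^ 2)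
    (y z u : Fin n → ℝ) (hz : z = softThresh (γ * lam) (y - γ • (A.mulVec y + b))) :
    2 * γ * (Fobj A b lam z - Fobj A b lam u)
      ≤ ∑ i, (y i - u i) ^ 2 - ∑ i, (z i - u i) ^ 2 := by
  have hc : ∀ i, 2 * γ * ((A.mulVec y + b) i * (z i - u i)) + (z i - y i) ^ 2
      + 2 * γ * lam * (|z i| - |u i|) ≤ (y i - u i) ^ 2 - (z i - u i) ^ 2 := by
    intro i
    have h := soft_ineq (γ * lam) ((y - γ • (A.mulVec y + b)) i) (u i) (mul_pos hγ hlam)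
    have hzi : z i = Real.sign ((y - γ • (A.mulVec y + b)) i)
        * max (|(y - γ • (A.mulVec y + b)) i| - γ * lam) 0 := by rw [hz]; rfl
    rw [← hzi] at h
    have e : (y - γ • (A.mulVec y + b)) i = y i - γ * (A.mulVec y + b) i := rfl
    rw [e] at h
    nlinarith
  have hsum := Finset.sum_le_sum (fun i (_ : i ∈ Finset.univ) => hc i)
  simp only [Finset.sum_add_distrib, Finset.sum_sub_distrib, ← Finset.mul_sum] at hsum
  have hg : ∑ i, (A.mulVec y + b) i * (z i - u i)
      = A.mulVec y ⬝ᵥ (z - y) - A.mulVec y ⬝ᵥ (u - y) + b ⬝ᵥ z - b ⬝ᵥ u := by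
    have : ∑ i, (A.mulVec y + b) i * (z i - u i) = (A.mulVec y + b) ⬝ᵥ (z - u) := rfl
    rw [this]
    simp only [add_dotProduct, dotProduct_sub]
    ring
  have h1 := hQ (z - y)
  have h2 : 0 ≤ (u - y) ⬝ᵥ A.mulVec (u - y) := by
    simpa using hA.posSemidef.dotProduct_mulVec_nonneg (u - y)
  have h2' := mul_nonneg hγ.le h2
  have e1 := quad_expand A hA.1 y z
  have e2 := quad_expand A hA.1 y u
  simp only [Pi.sub_apply] at h1
  rw [hg] at hsum
  unfold Fobj
  rw [e1, e2]
  linarith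

/-- ISTA sublinear rate: with `A` symmetric positive definite, `L = λ_max(A)`,
`λ > 0`, `0 < γ ≤ 1/L`, and `x⋆` a minimizer of `F`, the ISTA iterates satisfy
`F(x_k) - F(x⋆) ≤ ‖x_0 - x⋆‖₂² / (2γk)` for all `k ≥ 1`; in particular
`F(x_k) → F(x⋆)`. -/
theorem ista_rate
    {n : ℕ} (A : Matrix (Fin n) (Fin n) ℝ) (hA : A.PosDef)
    (b : Fin n → ℝ) (lam γ L : ℝ) (hlam : 0 < lam)
    (hL : L = ⨆ i, hA.1.eigenvalues i)
    (hγ : 0 < γ) (hγL : γ ≤ 1 / L)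
    (xstar : Fin n → ℝ) (hstar : ∀ z : Fin n → ℝ, Fobj A b lam xstar ≤ Fobj A b lam z)
    (x : ℕ → Fin n → ℝ)
    (hx : ∀ k, x (k + 1) = softThresh (γ * lam) (x k - γ • (A.mulVec (x k) + b))) :
    (∀ k : ℕ, 1 ≤ k →
      Fobj A b lam (x k) - Fobj A b lam xstar
        ≤ (∑ i, (x 0 i - xstar i) ^ 2) / (2 * γ * k)) ∧
    Tendsto (fun k => Fobj A b lam (x k)) atTop (nhds (Fobj A b lam xstar)) := by
  have hQ : ∀ v : Fin n → ℝ, γ * (v ⬝ᵥ A.mulVec v) ≤ ∑ i, v i ^ 2 := by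
    intro v
    have hLpos : 0 < L := by
      by_contra hc
      have : 1 / L ≤ 0 := one_div_nonpos.2 (not_lt.1 hc)
      linarith
    have h1 := quad_le A hA.1 v
    rw [← hL] at h1
    have h2 : γ * L ≤ 1 := by rwa [le_div_iff₀ hLpos] at hγL
    have hs : 0 ≤ ∑ i, v i ^ 2 := Finset.sum_nonneg fun i _ => sq_nonneg _
    nlinarith [mul_le_mul_of_nonneg_left h1 hγ.le, mul_le_mul_of_nonneg_right h2 hs]
  have step := fun k u => ista_step A hA b lam γ hlam hγ hQ (x k) (x (k + 1)) u (hx k)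
  have mono : ∀ k, Fobj A b lam (x (k + 1)) ≤ Fobj A b lam (x k) := by
    intro k
    have h := step k (x k)
    have hs : 0 ≤ ∑ i, (x (k + 1) i - x k i) ^ 2 := Finset.sum_nonneg fun i _ => sq_nonneg _
    simp only [sub_self, ne_eq, OfNat.ofNat_ne_zero, not_false_eq_true, zero_pow,
      Finset.sum_const_zero] at h
    by_contra hc
    have := mul_pos (mul_pos two_pos hγ) (sub_pos.2 (not_le.1 hc))
    linarith
  have tele : ∀ k : ℕ, 2 * γ * k * (Fobj A b lam (x k) - Fobj A b lam xstar)
      + ∑ i, (x k i - xstar i) ^ 2 ≤ ∑ i, (x 0 i - xstar i) ^ 2 := by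
    intro k
    induction k with
    | zero => simp
    | succ k ih =>
      have h := step k xstar
      have hk : 0 ≤ 2 * γ * (k : ℝ) := by positivity
      have hm := mul_le_mul_of_nonneg_left (mono k) hk
      push_cast
      linarith
  have rate : ∀ k : ℕ, 1 ≤ k →
      Fobj A b lam (x k) - Fobj A b lam xstar
        ≤ (∑ i, (x 0 i - xstar i) ^ 2) / (2 * γ * k) := by
    intro k hk
    have hk' : (0 : ℝ) < k := by exact_mod_cast hk
    rw [le_div_iff₀ (by positivity)]
    have hs : 0 ≤ ∑ i, (x k i - xstar i) ^ 2 := Finset.sum_nonneg fun i _ => sq_nonneg _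
    linarith [tele k]
  refine ⟨rate, ?_⟩
  have hlim : Tendsto (fun k : ℕ => Fobj A b lam xstar
      + (∑ i, (x 0 i - xstar i) ^ 2) / (2 * γ) / (k : ℝ)) atTop (nhds (Fobj A b lam xstar)) := by
    simpa using (tendsto_const_div_atTop_nhds_zero_nat
      ((∑ i, (x 0 i - xstar i) ^ 2) / (2 * γ))).const_add (Fobj A b lam xstar)
  refine tendsto_of_tendsto_of_tendsto_of_le_of_le' tendsto_const_nhds hlim
    (Eventually.of_forall fun k => hstar (x k)) ?_
  filter_upwards [eventually_ge_atTop 1] with k hk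
  have := rate k hk
  rw [div_div]
  linarith
end

section
/- Fix y ∈ ℝⁿ and B > 0, and let K = {x ∈ ℝⁿ : ‖x‖₁ ≤ B}. If ‖y‖₁ ≤ B, then the Euclidean projection of y onto K is y itself. If ‖y‖₁ > B and θ⋆ > 0 satisfies ‖S_{θ⋆}(y)‖₁ = B, then S_{θ⋆}(y) is the unique minimizer of x ↦ ½‖x − y‖₂² over K, i.e. S_{θ⋆}(y) = Proj_K(y). -/
theorem softThresh_coord {n : ℕ} (θ : ℝ) (hθ : 0 < θ) (y : Fin n → ℝ) (i : Fin n) (x : ℝ) :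
    (softThresh θ y i - y i) ^ 2 + (x - softThresh θ y i) ^ 2
      + 2 * θ * (|softThresh θ y i| - |x|) ≤ (x - y i) ^ 2 := by
  have h1 := mul_le_mul_of_nonneg_left (le_abs_self x) hθ.le
  have h2 := mul_le_mul_of_nonneg_left (neg_abs_le x) hθ.le
  unfold softThresh
  by_cases h : |y i| ≤ θ
  · rw [max_eq_right (by linarith)]
    have h3 : x * y i ≤ |x| * θ :=
      (le_abs_self _).trans (by rw [abs_mul]; gcongr)
    simp only [mul_zero, abs_zero]
    nlinarith
  · push Not at h
    rw [max_eq_left (by linarith)]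
    rcases lt_trichotomy (y i) 0 with hy | hy | hy
    · rw [Real.sign_of_neg hy]
      rw [abs_of_neg hy] at h ⊢
      rw [abs_of_neg (by linarith : -1 * (-y i - θ) < 0)]
      nlinarith
    · rw [hy, abs_zero] at h
      linarith
    · rw [Real.sign_of_pos hy]
      rw [abs_of_pos hy] at h ⊢
      rw [abs_of_pos (by linarith : 0 < 1 * (y i - θ))]
      nlinarith

theorem sum_sq_sub_pos {n : ℕ} (x z : Fin n → ℝ) (h : x ≠ z) :
    0 < ∑ i, (x i - z i) ^ 2 := by
  obtain ⟨j, hj⟩ := Function.ne_iff.mp h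
  exact Finset.sum_pos' (fun i _ => sq_nonneg _)
    ⟨j, Finset.mem_univ j, by have := sub_ne_zero.mpr hj; positivity⟩

/-- Projection onto the ℓ1-ball `K = {x : ‖x‖₁ ≤ B}`: if `‖y‖₁ ≤ B` the
projection of `y` is `y` itself; if `‖y‖₁ > B` and `θ⋆ > 0` satisfies
`‖S_{θ⋆}(y)‖₁ = B`, then `S_{θ⋆}(y)` is the unique minimizer of
`x ↦ ½‖x - y‖₂²` over `K`. -/
theorem softThresh_eq_l1_projection
    {n : ℕ} (y : Fin n → ℝ) (B : ℝ) (hB : 0 < B) :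
    ((∑ i, |y i| ≤ B) →
      ∀ x : Fin n → ℝ, (∑ i, |x i| ≤ B) → x ≠ y →
        (1 / 2) * (∑ i, (y i - y i) ^ 2) < (1 / 2) * (∑ i, (x i - y i) ^ 2)) ∧
    (∀ θstar : ℝ, B < ∑ i, |y i| → 0 < θstar →
      (∑ i, |softThresh θstar y i|) = B →
      ∀ x : Fin n → ℝ, (∑ i, |x i| ≤ B) → x ≠ softThresh θstar y →
        (1 / 2) * (∑ i, (softThresh θstar y i - y i) ^ 2)
          < (1 / 2) * (∑ i, (x i - y i) ^ 2)) := by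
  constructor
  · intro _ x _ hne
    have := sum_sq_sub_pos x y hne
    simpa using this
  · intro θ _ hθ hS x hx hne
    have hp := sum_sq_sub_pos x _ hne
    have hs := Finset.sum_le_sum (s := Finset.univ)
      (fun i _ => softThresh_coord θ hθ y i (x i))
    rw [Finset.sum_add_distrib, Finset.sum_add_distrib, ← Finset.mul_sum,
      Finset.sum_sub_distrib, hS] at hs
    have : 0 ≤ 2 * θ * (B - ∑ i, |x i|) := mul_nonneg (by linarith) (by linarith)
    linarith
end

section
/- Fix y ∈ ℝⁿ, B > 0, and define s(θ) = Σ_{i=1}^n max(|y_i| − θ, 0). Let θ ≥ 0 and 0 < η ≤ 1 be such that r := s(θ) − B > 0 and s(θ + ηr) ≥ B. Then 0 ≤ s(θ + ηr) − B ≤ (1 − η) r. -/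
/-- One step of the threshold loop contracts the budget violation: if
`r = s(θ) - B > 0` and `s(θ + ηr) ≥ B` with `0 < η ≤ 1`, then
`0 ≤ s(θ + ηr) - B ≤ (1 - η) r`, where `s(θ) = Σ_i max(|y_i| - θ, 0)`. -/
theorem threshold_loop_contraction
    {n : ℕ} (y : Fin n → ℝ) (B η θ r : ℝ) (hB : 0 < B)
    (hη0 : 0 < η) (hη1 : η ≤ 1) (hθ : 0 ≤ θ)
    (hr : r = (∑ i, max (|y i| - θ) 0) - B) (hrpos : 0 < r)
    (hge : B ≤ ∑ i, max (|y i| - (θ + η * r)) 0) :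
    0 ≤ (∑ i, max (|y i| - (θ + η * r)) 0) - B ∧
    (∑ i, max (|y i| - (θ + η * r)) 0) - B ≤ (1 - η) * r := by
  refine ⟨by linarith, ?_⟩
  have hd : 0 < η * r := mul_pos hη0 hrpos
  obtain ⟨j, -, hj⟩ : ∃ j ∈ Finset.univ, 0 < max (|y j| - (θ + η * r)) 0 := by
    by_contra! h
    have := Finset.sum_nonpos h
    linarith
  have hj' : 0 < |y j| - (θ + η * r) := by
    rcases lt_max_iff.1 hj with h | h
    · exact h
    · exact absurd h (lt_irrefl _)
  have key : max (|y j| - θ) 0 - max (|y j| - (θ + η * r)) 0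
      ≤ ∑ i, (max (|y i| - θ) 0 - max (|y i| - (θ + η * r)) 0) := by
    refine Finset.single_le_sum
      (f := fun i => max (|y i| - θ) 0 - max (|y i| - (θ + η * r)) 0) ?_ (Finset.mem_univ j)
    intro i _
    exact sub_nonneg.2 (max_le_max (by linarith) le_rfl)
  rw [Finset.sum_sub_distrib, max_eq_left hj'.le,
    max_eq_left (by linarith : 0 ≤ |y j| - θ)] at key
  linarith
end

section
/- Fix y ∈ ℝⁿ, B > 0, 0 < η ≤ 1/n, and define s(θ) = Σ_{i=1}^n max(|y_i| − θ, 0). Consider the threshold loop θ_0 = 0, θ_{t+1} = θ_t + η · max(s(θ_t) − B, 0). Then the sequence (θ_t) is nondecreasing and bounded above by max_i |y_i|, hence converges to some θ⋆ ≥ 0, and the limit satisfies s(θ⋆) = min(B, ‖y‖₁). In particular, S_{θ⋆}(y) is the Euclidean projection of y onto the ℓ1-ball {x : ‖x‖₁ ≤ B}. -/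
open Filter

lemma soft_abs {n : ℕ} (θ : ℝ) (hθ : 0 ≤ θ) (y : Fin n → ℝ) (i : Fin n) :
    |softThresh θ y i| = max (|y i| - θ) 0 := by
  unfold softThresh
  rw [abs_mul, abs_of_nonneg (le_max_right (|y i| - θ) 0)]
  rcases lt_trichotomy (y i) 0 with h | h | h
  · rw [Real.sign_of_neg h]; simp
  · simp [h, hθ]
  · rw [Real.sign_of_pos h]; simp

lemma soft_var {n : ℕ} (θ : ℝ) (hθ : 0 ≤ θ) (y : Fin n → ℝ) (i : Fin n) (x : ℝ) :
    (x - softThresh θ y i) * (y i - softThresh θ y i) ≤ θ * (|x| - max (|y i| - θ) 0) := by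
  unfold softThresh
  rcases le_total (|y i|) θ with h | h
  · rw [max_eq_right (by linarith)]
    simp only [mul_zero, sub_zero]
    calc x * y i ≤ |x * y i| := le_abs_self _
      _ = |y i| * |x| := by rw [abs_mul, mul_comm]
      _ ≤ θ * |x| := by gcongr
  · rw [max_eq_left (by linarith)]
    rcases lt_trichotomy (y i) 0 with h0 | h0 | h0
    · rw [Real.sign_of_neg h0, abs_of_neg h0]
      nlinarith [neg_abs_le x]
    · have : θ = 0 := by
        rw [h0, abs_zero] at h; linarith
      simp [h0, this]
    · rw [Real.sign_of_pos h0, abs_of_pos h0]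
      nlinarith [le_abs_self x]

lemma soft_proj {n : ℕ} (θ B : ℝ) (hθ : 0 ≤ θ) (y : Fin n → ℝ)
    (hc : θ * (B - ∑ i, max (|y i| - θ) 0) = 0) (x : Fin n → ℝ) (hx : ∑ i, |x i| ≤ B)
    (hne : x ≠ softThresh θ y) :
    (1 / 2) * (∑ i, (softThresh θ y i - y i) ^ 2) < (1 / 2) * (∑ i, (x i - y i) ^ 2) := by
  have h1 : ∑ i, (x i - softThresh θ y i) * (y i - softThresh θ y i) ≤ 0 := by
    calc _ ≤ ∑ i, θ * (|x i| - max (|y i| - θ) 0) :=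
          Finset.sum_le_sum fun i _ => soft_var θ hθ y i (x i)
      _ = θ * (∑ i, |x i| - ∑ i, max (|y i| - θ) 0) := by
          rw [← Finset.mul_sum, Finset.sum_sub_distrib]
      _ ≤ θ * (B - ∑ i, max (|y i| - θ) 0) := by gcongr
      _ = 0 := hc
  have h2 : 0 < ∑ i, (x i - softThresh θ y i) ^ 2 := by
    obtain ⟨j, hj⟩ := Function.ne_iff.mp hne
    apply Finset.sum_pos' (fun i _ => sq_nonneg _)
    exact ⟨j, Finset.mem_univ _, by have := sub_ne_zero.mpr hj; positivity⟩
  have h3 : ∑ i, (x i - y i) ^ 2 = ∑ i, (softThresh θ y i - y i) ^ 2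
      + ∑ i, (x i - softThresh θ y i) ^ 2
      - 2 * ∑ i, (x i - softThresh θ y i) * (y i - softThresh θ y i) := by
    rw [Finset.mul_sum, ← Finset.sum_add_distrib, ← Finset.sum_sub_distrib]
    exact Finset.sum_congr rfl fun i _ => by ring
  linarith

lemma s_lip {n : ℕ} (y : Fin n → ℝ) (a b : ℝ) (h : a ≤ b) :
    ∑ i, max (|y i| - a) 0 ≤ ∑ i, max (|y i| - b) 0 + n * (b - a) := by
  have : (n : ℝ) * (b - a) = ∑ _i : Fin n, (b - a) := by simp; ring
  rw [this, ← Finset.sum_add_distrib]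
  refine Finset.sum_le_sum fun i _ => max_le ?_ ?_
  · linarith [le_max_left (|y i| - b) 0]
  · linarith [le_max_right (|y i| - b) 0]

/-- The threshold loop `θ_{t+1} = θ_t + η max(s(θ_t) - B, 0)` with `θ_0 = 0`
and `0 < η ≤ 1/n` is nondecreasing, bounded above by `max_i |y_i|`, and
converges to some `θ⋆ ≥ 0` with `s(θ⋆) = min(B, ‖y‖₁)`; consequently
`S_{θ⋆}(y)` is the Euclidean projection of `y` onto the ℓ1-ball of radius `B`. -/
theorem threshold_loop_computes_l1_projection
    {n : ℕ} (y : Fin n → ℝ) (B η : ℝ) (hB : 0 < B)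
    (hη0 : 0 < η) (hηn : η ≤ 1 / (n : ℝ))
    (θ : ℕ → ℝ) (hθ0 : θ 0 = 0)
    (hθrec : ∀ t, θ (t + 1) = θ t + η * max ((∑ i, max (|y i| - θ t) 0) - B) 0) :
    Monotone θ ∧
    (∀ t, θ t ≤ ⨆ i, |y i|) ∧
    ∃ θstar : ℝ, 0 ≤ θstar ∧ Tendsto θ atTop (nhds θstar) ∧
      (∑ i, max (|y i| - θstar) 0) = min B (∑ i, |y i|) ∧
      (∑ i, |softThresh θstar y i| ≤ B) ∧
      (∀ x : Fin n → ℝ, (∑ i, |x i| ≤ B) → x ≠ softThresh θstar y →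
        (1 / 2) * (∑ i, (softThresh θstar y i - y i) ^ 2)
          < (1 / 2) * (∑ i, (x i - y i) ^ 2)) := by
  have hn : 0 < (n : ℝ) := by
    rcases Nat.eq_zero_or_pos n with h | h
    · subst h; norm_num at hηn; linarith
    · exact_mod_cast h
  have hηn' : n * η ≤ 1 := by
    rw [le_div_iff₀ hn] at hηn; linarith
  have hmono : Monotone θ := monotone_nat_of_le_succ fun t => by
    rw [hθrec]
    have := mul_nonneg hη0.le (le_max_right ((∑ i, max (|y i| - θ t) 0) - B) 0)
    linarith
  have hM : ∀ i, |y i| ≤ ⨆ i, |y i| := fun i =>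
    le_ciSup (f := fun i => |y i|) (Set.finite_range _).bddAbove i
  have hM0 : 0 ≤ ⨆ i, |y i| := Real.iSup_nonneg fun i => abs_nonneg _
  have hbd : ∀ t, θ t ≤ ⨆ i, |y i| := by
    intro t
    induction t with
    | zero => rw [hθ0]; exact hM0
    | succ t ih =>
      have h1 := s_lip y (θ t) _ ih
      have h2 : ∑ i, max (|y i| - ⨆ i, |y i|) 0 = 0 :=
        Finset.sum_eq_zero fun i _ => max_eq_right (by linarith [hM i])
      rw [h2] at h1
      have h3 : max ((∑ i, max (|y i| - θ t) 0) - B) 0 ≤ n * ((⨆ i, |y i|) - θ t) :=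
        max_le (by linarith) (mul_nonneg hn.le (by linarith))
      have h4 := mul_le_mul_of_nonneg_left h3 hη0.le
      have h5 := mul_le_mul_of_nonneg_right hηn' (sub_nonneg.mpr ih)
      rw [hθrec]
      nlinarith
  have hlim : Tendsto θ atTop (nhds (⨆ t, θ t)) :=
    tendsto_atTop_ciSup hmono ⟨_, by rintro _ ⟨t, rfl⟩; exact hbd t⟩
  refine ⟨hmono, hbd, ?_⟩
  generalize (⨆ t, θ t) = L at hlim
  have hL : 0 ≤ L := ge_of_tendsto' hlim fun t => hθ0 ▸ hmono (Nat.zero_le t)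
  have hcont : Continuous fun a : ℝ => ∑ i, max (|y i| - a) 0 := by fun_prop
  have hslim : Tendsto (fun t => ∑ i, max (|y i| - θ t) 0) atTop
      (nhds (∑ i, max (|y i| - L) 0)) := (hcont.tendsto L).comp hlim
  have hle : ∑ i, max (|y i| - L) 0 ≤ B := by
    have hc2 : Continuous fun a : ℝ => a + η * max ((∑ i, max (|y i| - a) 0) - B) 0 := by
      fun_prop
    have h1 : Tendsto (fun t => θ (t + 1)) atTop
        (nhds (L + η * max ((∑ i, max (|y i| - L) 0) - B) 0)) := by
      simp only [hθrec]
      exact (hc2.tendsto L).comp hlim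
    have h2 := tendsto_nhds_unique h1 (hlim.comp (tendsto_add_atTop_nat 1))
    have h3 : η * max ((∑ i, max (|y i| - L) 0) - B) 0 = 0 := by linarith
    have h4 := (mul_eq_zero.mp h3).resolve_left hη0.ne'
    linarith [le_max_left ((∑ i, max (|y i| - L) 0) - B) 0]
  have key : (∑ i, max (|y i| - L) 0) = min B (∑ i, |y i|) ∧
      L * (B - ∑ i, max (|y i| - L) 0) = 0 := by
    have hs0 : ∑ i, max (|y i| - 0) 0 = ∑ i, |y i| :=
      Finset.sum_congr rfl fun i _ => by simp
    rcases le_total (∑ i, |y i|) B with h | h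
    · have hz : ∀ t, θ t = 0 := by
        intro t
        induction t with
        | zero => exact hθ0
        | succ t ih => rw [hθrec, ih, hs0, max_eq_right (by linarith)]; simp
      have hL0 : L = 0 := tendsto_nhds_unique hlim (by
        rw [show θ = fun _ => 0 from funext hz]; exact tendsto_const_nhds)
      rw [hL0, hs0, min_eq_right h]
      simp
    · have hge : ∀ t, B ≤ ∑ i, max (|y i| - θ t) 0 := by
        intro t
        induction t with
        | zero => rw [hθ0, hs0]; exact h
        | succ t ih =>
          have h1 := s_lip y (θ t) (θ (t + 1)) (hmono (Nat.le_succ t))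
          have h2 := hθrec t
          rw [max_eq_left (by linarith)] at h2
          have h5 := mul_le_mul_of_nonneg_right hηn' (sub_nonneg.mpr ih)
          have h6 : n * (θ (t + 1) - θ t) = n * η * ((∑ i, max (|y i| - θ t) 0) - B) := by
            rw [h2]; ring
          linarith
      have := le_antisymm hle (ge_of_tendsto' hslim hge)
      rw [this, min_eq_left h]
      simp
  refine ⟨L, hL, hlim, key.1, ?_, soft_proj L B hL y key.2⟩
  simp only [soft_abs L hL]
  exact hle
end
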